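/- Let Ψ ⊆ Φ be a sub-root-system and β = wW_Ψ a coset of W_Ψ in W; let w^β (resp. w_β) denote the unique element of β with w^β(Ψ⁺) ⊆ Φ⁺ (resp. w_β(Ψ⁺) ⊆ Φ⁻). Then Ψ′ := w^β(Ψ) is again a sub-root-system of Φ, with Ψ′⁺ = w^β(Ψ⁺) and W_{Ψ′} = w^β W_Ψ (w^β)⁻¹. Moreover, for any coset γ = w′W_{Ψ′} of W_{Ψ′}, with extreme elements w^γ (the unique element of γ mapping Ψ′⁺ into Φ⁺) and w_γ (the unique element mapping Ψ′⁺ into Φ⁻), the product set γ·β = {xy : x ∈ γ, y ∈ β} is a single coset of W_Ψ, and its extreme elements satisfy: w^γ w^β = w^{γβ}, w^γ w_β = w_{γβ}, and w_γ w^β = w_{γβ}. (This is Corollary 4.2 of the paper.) -/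

import Mathlib

open scoped Pointwise

namespace Paper

/-- A finite reduced root system `Φ` in a vector space `V`, together with the coroots and
the corresponding reflections.  The reflection `refl α` is required to be given by the usual
formula on the roots. -/
structure RootSystemData (V : Type*) [AddCommGroup V] [Module ℝ V] where
  roots : Set V
  coroot : V → (V →ₗ[ℝ] ℝ)
  refl : V → (V ≃ₗ[ℝ] V)
  finite : roots.Finite
  ne_zero : ∀ α ∈ roots, α ≠ (0 : V)
  coroot_self : ∀ α ∈ roots, coroot α α = 2
  coroot_neg : ∀ α ∈ roots, coroot (-α) = -(coroot α)
  refl_apply : ∀ α ∈ roots, ∀ x : V, refl α x = x - (coroot α x) • α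
  refl_root_mem : ∀ α ∈ roots, ∀ β ∈ roots, refl α β ∈ roots
  reduced : ∀ α ∈ roots, ∀ t : ℝ, t • α ∈ roots → t • α = α ∨ t • α = -α

namespace RootSystemData

variable {V : Type*} [AddCommGroup V] [Module ℝ V]

/-- The reflection subgroup `W_Ψ` generated by the reflections in the elements of `Ψ`. -/
def weylOf (P : RootSystemData V) (Ψ : Set V) : Subgroup (V ≃ₗ[ℝ] V) :=
  Subgroup.closure { g | ∃ α ∈ Ψ, g = P.refl α }

/-- The Weyl group `W` of the root system. -/
def weyl (P : RootSystemData V) : Subgroup (V ≃ₗ[ℝ] V) :=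
  P.weylOf P.roots

/-- The left coset `w • W_Ψ`. -/
def coset (P : RootSystemData V) (Ψ : Set V) (w : V ≃ₗ[ℝ] V) : Set (V ≃ₗ[ℝ] V) :=
  { x | ∃ σ ∈ P.weylOf Ψ, x = w * σ }

/-- `Ψ` is a sub-root-system of `Φ`: closed under negation and under the reflections
at its own elements. -/
def IsSubsystem (P : RootSystemData V) (Ψ : Set V) : Prop :=
  Ψ ⊆ P.roots ∧ (∀ α ∈ Ψ, -α ∈ Ψ) ∧ ∀ α ∈ Ψ, ∀ β ∈ Ψ, P.refl α β ∈ Ψ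

/-- `w s_α w⁻¹ = s_{w α}` for all roots `α` and all `w ∈ W`. -/
def ConjCompat (P : RootSystemData V) : Prop :=
  ∀ α ∈ P.roots, ∀ w ∈ P.weyl, w * P.refl α * w⁻¹ = P.refl (w α)

end RootSystemData

/-- The length `ℓ(x) = #{α ∈ Φ⁺ : x α ∈ Φ⁻}` with respect to the positive system `Pos`. -/
noncomputable def len {V : Type*} [AddCommGroup V] [Module ℝ V]
    (Pos : Set V) (x : V ≃ₗ[ℝ] V) : ℕ :=
  {α | α ∈ Pos ∧ x α ∈ -Pos}.ncard

/-- `Pos` is a positive system for `Φ`: it is cut out of `Φ` by a linear functional that is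
nonzero on all roots. -/
def IsPositiveSystem {V : Type*} [AddCommGroup V] [Module ℝ V] (Φ Pos : Set V) : Prop :=
  ∃ f : V →ₗ[ℝ] ℝ, (∀ α ∈ Φ, f α ≠ 0) ∧ Pos = {α | α ∈ Φ ∧ 0 < f α}

/-- `α` is an indecomposable element of `S`: it lies in `S` and is not the sum of two
elements of `S`. -/
def Indec {V : Type*} [AddCommGroup V] (S : Set V) (α : V) : Prop :=
  α ∈ S ∧ ¬ ∃ x ∈ S, ∃ y ∈ S, α = x + y

/-- `Δ` is a base of the positive system `Pos`: every element of `Pos` is a nonnegative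
linear combination of elements of `Δ`. -/
def IsBase {V : Type*} [AddCommGroup V] [Module ℝ V] (Pos Δ : Set V) : Prop :=
  Δ ⊆ Pos ∧ ∀ α ∈ Pos, ∃ c : V → ℝ, (∀ x, 0 ≤ c x) ∧ (∀ x, x ∉ Δ → c x = 0) ∧
    {x | c x ≠ 0}.Finite ∧ α = ∑ᶠ x, c x • x

/-- `prodUpTo P δ j = s_{δ_j} ⋯ s_{δ_2} s_{δ_1}` (the product of the first `j` reflections,
applied from the right). -/
noncomputable def prodUpTo {V : Type*} [AddCommGroup V] [Module ℝ V]
    (P : RootSystemData V) {N : ℕ} (δ : Fin N → V) : ℕ → (V ≃ₗ[ℝ] V)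
  | 0 => 1
  | j + 1 => (if h : j < N then P.refl (δ ⟨j, h⟩) else 1) * prodUpTo P δ j

end Paper

namespace Paper.RootSystemData

variable {V : Type*} [AddCommGroup V] [Module ℝ V] {P : RootSystemData V}

theorem weylOf_mono {Ψ Ψ' : Set V} (h : Ψ ⊆ Ψ') : P.weylOf Ψ ≤ P.weylOf Ψ' :=
  Subgroup.closure_mono fun _ ⟨α, hα, hg⟩ => ⟨α, h hα, hg⟩

theorem refl_mem_weylOf {Ψ : Set V} {α : V} (hα : α ∈ Ψ) : P.refl α ∈ P.weylOf Ψ :=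
  Subgroup.subset_closure ⟨α, hα, rfl⟩

theorem refl_self {α : V} (hα : α ∈ P.roots) : P.refl α α = -α := by
  rw [P.refl_apply α hα, P.coroot_self α hα, two_smul]; abel

theorem refl_refl {α : V} (hα : α ∈ P.roots) (x : V) : P.refl α (P.refl α x) = x := by
  rw [P.refl_apply α hα x, map_sub, map_smul, refl_self hα, P.refl_apply α hα x, smul_neg]
  abel

theorem refl_mul_self {α : V} (hα : α ∈ P.roots) : P.refl α * P.refl α = 1 :=
  LinearEquiv.ext fun x => refl_refl hα x

theorem refl_neg {α : V} (hα : α ∈ P.roots) (hα' : -α ∈ P.roots) :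
    P.refl (-α) = P.refl α := by
  ext x
  rw [P.refl_apply _ hα', P.refl_apply _ hα, P.coroot_neg α hα]
  simp

theorem neg_mem_roots {α : V} (hα : α ∈ P.roots) : -α ∈ P.roots :=
  refl_self hα ▸ P.refl_root_mem α hα α hα

theorem isSubsystem_roots : P.IsSubsystem P.roots :=
  ⟨subset_rfl, fun _ => neg_mem_roots, P.refl_root_mem⟩

theorem IsSubsystem.apply_mem {Ψ : Set V} (hΨ : P.IsSubsystem Ψ) {σ : V ≃ₗ[ℝ] V}
    (hσ : σ ∈ P.weylOf Ψ) : ∀ {α : V}, α ∈ Ψ → σ α ∈ Ψ := by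
  refine Subgroup.closure_induction (p := fun σ _ => ∀ {α : V}, α ∈ Ψ → σ α ∈ Ψ)
    ?_ (fun h => h) (fun x y _ _ hx hy _ h => hx (hy h)) ?_ hσ
  · rintro _ ⟨α, hα, rfl⟩ β hβ
    exact hΨ.2.2 α hα β hβ
  · intro x _ hx α hα
    have himage : x '' Ψ = Ψ := Set.eq_of_subset_of_ncard_le
      (Set.image_subset_iff.2 fun _ h => hx h)
      (Set.ncard_image_of_injective Ψ x.injective).ge (P.finite.subset hΨ.1)
    obtain ⟨β, hβ, rfl⟩ := himage.symm ▸ hα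
    simpa using hβ

/-- The canonical invariant bilinear form `∑ γ∨(x) γ∨(y)`. -/
noncomputable def form (P : RootSystemData V) (x y : V) : ℝ :=
  ∑ γ ∈ P.finite.toFinset, P.coroot γ x * P.coroot γ y

theorem coroot_refl (hconj : P.ConjCompat) {α γ : V} (hα : α ∈ P.roots) (hγ : γ ∈ P.roots)
    (x : V) : P.coroot (P.refl α γ) (P.refl α x) = P.coroot γ x := by
  have h := congrArg (fun g : V ≃ₗ[ℝ] V => g (P.refl α x))
    (hconj γ hγ (P.refl α) (refl_mem_weylOf hα))
  have hinv : (P.refl α)⁻¹ = P.refl α := inv_eq_of_mul_eq_one_left (refl_mul_self hα)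
  have hmem := P.refl_root_mem α hα γ hγ
  rw [hinv] at h
  simp only [LinearEquiv.mul_apply, refl_refl hα, P.refl_apply _ hmem, P.refl_apply γ hγ,
    map_sub, map_smul, sub_right_inj] at h
  exact (smul_left_injective ℝ (P.ne_zero _ hmem) h).symm

theorem form_refl (hconj : P.ConjCompat) {α : V} (hα : α ∈ P.roots) (x y : V) :
    P.form (P.refl α x) (P.refl α y) = P.form x y := by
  unfold form
  symm
  refine Finset.sum_nbij' (P.refl α) (P.refl α) ?_ ?_ ?_ ?_ ?_
  · intro γ hγ
    simpa using P.refl_root_mem α hα γ (by simpa using hγ)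
  · intro γ hγ
    simpa using P.refl_root_mem α hα γ (by simpa using hγ)
  · exact fun γ _ => refl_refl hα γ
  · exact fun γ _ => refl_refl hα γ
  · intro γ hγ
    have hγ' : γ ∈ P.roots := by simpa using hγ
    rw [coroot_refl hconj hα hγ', coroot_refl hconj hα hγ']

theorem form_self_pos {α : V} (hα : α ∈ P.roots) : 0 < P.form α α := by
  refine Finset.sum_pos' (fun γ _ => mul_self_nonneg _) ⟨α, by simpa using hα, ?_⟩
  rw [P.coroot_self α hα]; norm_num

theorem two_mul_form (hconj : P.ConjCompat) {α : V} (hα : α ∈ P.roots) (x : V) :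
    2 * P.form α x = P.coroot α x * P.form α α := by
  have h := form_refl hconj hα α x
  rw [refl_self hα, P.refl_apply α hα] at h
  have h' : P.form (-α) (x - P.coroot α x • α)
      = -P.form α x + P.coroot α x * P.form α α := by
    simp only [form, Finset.mul_sum, ← Finset.sum_neg_distrib, ← Finset.sum_add_distrib]
    refine Finset.sum_congr rfl fun γ _ => ?_
    simp only [map_neg, map_sub, map_smul, smul_eq_mul]
    ring
  linarith

open scoped NNReal

theorem eq_zero_or_pos_of_mem_span {f : V →ₗ[ℝ] ℝ} {S : Set V} (hS : ∀ x ∈ S, 0 < f x) {z : V}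
    (hz : z ∈ Submodule.span ℝ≥0 S) : z = 0 ∨ 0 < f z := by
  induction hz using Submodule.span_induction with
  | mem x hx => exact .inr (hS x hx)
  | zero => exact .inl rfl
  | add x y _ _ hx hy =>
    rcases hx with rfl | hx
    · simpa using hy
    · rcases hy with rfl | hy
      · simpa using Or.inr hx
      · exact .inr (by rw [map_add]; exact add_pos hx hy)
  | smul a x _ hx =>
    rcases hx with rfl | hx
    · simp
    · rcases eq_or_ne a 0 with rfl | ha
      · simp
      · right
        rw [NNReal.smul_def, map_smul]
        exact mul_pos (NNReal.coe_pos.2 (pos_iff_ne_zero.2 ha)) hx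

/-- The roots of `Ψ` on which `f` is positive. -/
def posPart (Ψ : Set V) (f : V →ₗ[ℝ] ℝ) : Set V := {α | α ∈ Ψ ∧ 0 < f α}

/-- A positive root is simple if its reflection permutes the other positive roots. -/
def IsSimple (P : RootSystemData V) (Ψ : Set V) (f : V →ₗ[ℝ] ℝ) (α : V) : Prop :=
  α ∈ posPart Ψ f ∧ ∀ β ∈ posPart Ψ f, β ≠ α → 0 < f (P.refl α β)

theorem IsSubsystem.exists_spanning_simple {Ψ : Set V} (hΨ : P.IsSubsystem Ψ)
    {f : V →ₗ[ℝ] ℝ} (hf : ∀ α ∈ Ψ, f α ≠ 0) :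
    ∃ Δ : Set V, (∀ α ∈ Δ, P.IsSimple Ψ f α) ∧
      posPart Ψ f ⊆ Submodule.span ℝ≥0 Δ := by
  have hfin : (posPart Ψ f).Finite := (P.finite.subset hΨ.1).subset fun _ h => h.1
  have hcand : {Δ : Set V | Δ ⊆ posPart Ψ f ∧
      posPart Ψ f ⊆ Submodule.span ℝ≥0 Δ}.Finite :=
    hfin.finite_subsets.subset fun _ h => h.1
  obtain ⟨Δ, ⟨hΔ, hspan⟩, hmin⟩ := hcand.exists_minimal
    ⟨posPart Ψ f, subset_rfl, Submodule.subset_span⟩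
  refine ⟨Δ, fun α hα => ⟨hΔ hα, fun β hβ hne => ?_⟩, hspan⟩
  have hαΨ := (hΔ hα).1
  have hnot : α ∉ Submodule.span ℝ≥0 (Δ \ {α}) := by
    intro hmem
    have hle : Submodule.span ℝ≥0 Δ ≤ Submodule.span ℝ≥0 (Δ \ {α}) := by
      refine Submodule.span_le.2 fun δ hδ => ?_
      by_cases h : δ = α
      · exact h ▸ hmem
      · exact Submodule.subset_span ⟨hδ, h⟩
    exact (hmin (y := Δ \ {α}) ⟨Set.sdiff_subset.trans hΔ, hspan.trans hle⟩ Set.sdiff_subset hα).2 rfl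
  by_contra hneg
  have hεΨ := hΨ.2.2 α hαΨ β hβ.1
  have hε : -P.refl α β ∈ posPart Ψ f :=
    ⟨hΨ.2.1 _ hεΨ, by
      rw [map_neg, neg_pos]; exact lt_of_le_of_ne (not_lt.1 hneg) (hf _ hεΨ)⟩
  have hdecomp : ∀ x ∈ posPart Ψ f, ∃ a : ℝ≥0, ∃ z ∈ Submodule.span ℝ≥0 (Δ \ {α}),
      x = a • α + z := fun x hx => by
    rw [← Submodule.mem_span_insert, Set.insert_sdiff_singleton, Set.insert_eq_of_mem hα]
    exact hspan hx
  obtain ⟨a, z, hz, hβz⟩ := hdecomp β hβ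
  obtain ⟨b, z', hz', hεz⟩ := hdecomp _ hε
  rw [NNReal.smul_def] at hβz hεz
  have hsum : z + z' = (P.coroot α β - a - b) • α := by
    rw [P.refl_apply α (hΨ.1 hαΨ)] at hεz
    rw [eq_sub_of_add_eq' hβz.symm, eq_sub_of_add_eq' hεz.symm]
    module
  rcases lt_or_ge 0 (P.coroot α β - a - b) with ht | ht
  · apply hnot
    have hα_eq : (P.coroot α β - a - b).toNNReal⁻¹ • (z + z') = α := by
      rw [hsum, NNReal.smul_def, NNReal.coe_inv, Real.coe_toNNReal _ ht.le,
        inv_smul_smul₀ ht.ne']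
    have hmem := Submodule.smul_mem _ (P.coroot α β - a - b).toNNReal⁻¹ (add_mem hz hz')
    rwa [hα_eq] at hmem
  · have hpos : ∀ x ∈ Δ \ {α}, 0 < f x := fun x hx => (hΔ hx.1).2
    have hfsum := congrArg f hsum
    rw [map_add, map_smul, smul_eq_mul] at hfsum
    have hle := mul_nonpos_of_nonpos_of_nonneg ht (hΔ hα).2.le
    have hz0 : z = 0 := by
      rcases eq_zero_or_pos_of_mem_span hpos hz with h | h
      · exact h
      · rcases eq_zero_or_pos_of_mem_span hpos hz' with h' | h'
        · rw [h', map_zero] at hfsum; linarith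
        · linarith
    rw [hz0, add_zero] at hβz
    rcases P.reduced α (hΨ.1 hαΨ) a (hβz ▸ hΨ.1 hβ.1) with h | h
    · exact hne (hβz.trans h)
    · have h1 := hβ.2
      rw [hβz, h, map_neg] at h1
      linarith [(hΔ hα).2]

theorem IsSubsystem.exists_simple_coroot_pos (hconj : P.ConjCompat) {Ψ : Set V}
    (hΨ : P.IsSubsystem Ψ) {f : V →ₗ[ℝ] ℝ} (hf : ∀ α ∈ Ψ, f α ≠ 0) {β : V}
    (hβ : β ∈ posPart Ψ f) : ∃ α, P.IsSimple Ψ f α ∧ 0 < P.coroot α β := by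
  obtain ⟨Δ, hΔ, hspan⟩ := hΨ.exists_spanning_simple hf
  by_contra! hcon
  have key : ∀ x ∈ Submodule.span ℝ≥0 Δ, P.form x β ≤ 0 := by
    intro x hx
    induction hx using Submodule.span_induction with
    | mem α hα =>
      have hroot := hΨ.1 (hΔ α hα).1.1
      have := two_mul_form hconj hroot β
      have := mul_nonpos_of_nonpos_of_nonneg (hcon α (hΔ α hα)) (form_self_pos hroot).le
      linarith
    | zero => simp [form]
    | add x y _ _ hx hy =>
      have : P.form (x + y) β = P.form x β + P.form y β := by
        simp [form, add_mul, Finset.sum_add_distrib]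
      linarith
    | smul a x _ hx =>
      have : P.form (a • x) β = a * P.form x β := by
        simp [form, NNReal.smul_def, mul_assoc, Finset.mul_sum]
      rw [this]
      exact mul_nonpos_of_nonneg_of_nonpos a.2 hx
  exact (key β (hspan hβ)).not_gt (form_self_pos (hΨ.1 hβ.1))

theorem IsSubsystem.weylOf_le_simple (hconj : P.ConjCompat) {Ψ : Set V}
    (hΨ : P.IsSubsystem Ψ) {f : V →ₗ[ℝ] ℝ} (hf : ∀ α ∈ Ψ, f α ≠ 0) :
    P.weylOf Ψ ≤ P.weylOf {α | P.IsSimple Ψ f α} := by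
  have hpos : ∀ β ∈ posPart Ψ f, P.refl β ∈ P.weylOf {α | P.IsSimple Ψ f α} := by
    by_contra! hcon
    have hfin : {β | β ∈ posPart Ψ f ∧
        P.refl β ∉ P.weylOf {α | P.IsSimple Ψ f α}}.Finite :=
      (P.finite.subset hΨ.1).subset fun _ h => h.1.1
    obtain ⟨β, ⟨hβ, hβG⟩, hmin⟩ := Set.exists_min_image _ f hfin hcon
    obtain ⟨α, hα, hαβ⟩ := hΨ.exists_simple_coroot_pos hconj hf hβ
    have hαroot := hΨ.1 hα.1.1
    have hαG : P.refl α ∈ P.weylOf {α | P.IsSimple Ψ f α} := refl_mem_weylOf hα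
    have hne : β ≠ α := by rintro rfl; exact hβG hαG
    have hβ' : P.refl α β ∈ posPart Ψ f := ⟨hΨ.2.2 α hα.1.1 β hβ.1, hα.2 β hβ hne⟩
    have hmem : P.refl (P.refl α β) ∈ P.weylOf {α | P.IsSimple Ψ f α} := by
      by_contra h
      have := hmin _ ⟨hβ', h⟩
      rw [P.refl_apply α hαroot, map_sub, map_smul, smul_eq_mul] at this
      linarith [mul_pos hαβ hα.1.2]
    rw [← hconj β (hΨ.1 hβ.1) _ (refl_mem_weylOf hαroot)] at hmem
    exact hβG (by
      simpa [mul_assoc] using mul_mem (mul_mem (inv_mem hαG) hmem) hαG)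
  refine (Subgroup.closure_le _).2 ?_
  rintro _ ⟨β, hβ, rfl⟩
  rcases (hf β hβ).lt_or_gt with h | h
  · have hneg := hΨ.2.1 β hβ
    rw [← refl_neg (hΨ.1 hβ) (hΨ.1 hneg)]
    exact hpos _ ⟨hneg, by rwa [map_neg, neg_pos]⟩
  · exact hpos β ⟨hβ, h⟩

theorem exists_list_of_mem_weylOf {S : Set V} (hS : S ⊆ P.roots) {g : V ≃ₗ[ℝ] V}
    (hg : g ∈ P.weylOf S) : ∃ L : List V, (∀ α ∈ L, α ∈ S) ∧ g = (L.map P.refl).prod := by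
  induction hg using Subgroup.closure_induction with
  | mem x hx =>
    obtain ⟨α, hα, rfl⟩ := hx
    exact ⟨[α], by simpa using hα, by simp⟩
  | one => exact ⟨[], by simp, by simp⟩
  | mul x y _ _ hx hy =>
    obtain ⟨L, hL, rfl⟩ := hx
    obtain ⟨M, hM, rfl⟩ := hy
    exact ⟨L ++ M, fun α hα => (List.mem_append.1 hα).elim (hL α) (hM α), by simp⟩
  | inv x _ hx =>
    obtain ⟨L, hL, rfl⟩ := hx
    refine ⟨L.reverse, fun α hα => hL α (List.mem_reverse.1 hα), ?_⟩
    rw [List.prod_inv_reverse, List.map_map, List.map_reverse]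
    congr 2
    exact List.map_congr_left fun α hα =>
      inv_eq_of_mul_eq_one_left (refl_mul_self (hS (hL α hα)))

/-- The exchange condition for words in the simple reflections. -/
theorem IsSubsystem.exchange (hconj : P.ConjCompat) {Ψ : Set V} (hΨ : P.IsSubsystem Ψ)
    {f : V →ₗ[ℝ] ℝ} (hf : ∀ α ∈ Ψ, f α ≠ 0) {α : V} (hα : P.IsSimple Ψ f α) (L : List V)
    (hL : ∀ δ ∈ L, P.IsSimple Ψ f δ) (hneg : f ((L.map P.refl).prod α) < 0) :
    ∃ M : List V, (∀ δ ∈ M, P.IsSimple Ψ f δ) ∧ M.length + 1 = L.length ∧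
      (M.map P.refl).prod = (L.map P.refl).prod * P.refl α := by
  induction L with
  | nil => exact absurd hα.1.2 (by simpa using hneg.le)
  | cons a L ih =>
    have ha := hL a (by simp)
    have hL' : ∀ δ ∈ L, P.IsSimple Ψ f δ := fun δ hδ => hL δ (by simp [hδ])
    have hg : (L.map P.refl).prod ∈ P.weylOf Ψ := by
      refine Subgroup.list_prod_mem _ fun x hx => ?_
      obtain ⟨δ, hδ, rfl⟩ := List.mem_map.1 hx
      exact refl_mem_weylOf (hL' δ hδ).1.1
    have hgα := hΨ.apply_mem hg hα.1.1
    rcases (hf _ hgα).lt_or_gt with h | h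
    · obtain ⟨M, hM, hlen, hprod⟩ := ih hL' h
      refine ⟨a :: M, ?_, by simpa using hlen, by simp [hprod, mul_assoc]⟩
      simpa using ⟨ha, hM⟩
    · have heq : (L.map P.refl).prod α = a := by
        by_contra hne
        rw [List.map_cons, List.prod_cons, LinearEquiv.mul_apply] at hneg
        exact hneg.not_gt (ha.2 _ ⟨hgα, h⟩ hne)
      refine ⟨L, hL', by simp, ?_⟩
      have hc := hconj α (hΨ.1 hα.1.1) _ (weylOf_mono hΨ.1 hg)
      rw [heq] at hc
      rw [List.map_cons, List.prod_cons, ← hc, inv_mul_cancel_right, mul_assoc,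
        refl_mul_self (hΨ.1 hα.1.1), mul_one]

theorem IsSubsystem.prod_eq_one_of_pos (hconj : P.ConjCompat) {Ψ : Set V}
    (hΨ : P.IsSubsystem Ψ) {f : V →ₗ[ℝ] ℝ} (hf : ∀ α ∈ Ψ, f α ≠ 0) (L : List V)
    (hL : ∀ δ ∈ L, P.IsSimple Ψ f δ)
    (hpos : ∀ α ∈ posPart Ψ f, 0 < f ((L.map P.refl).prod α)) : (L.map P.refl).prod = 1 := by
  induction hn : L.length using Nat.strong_induction_on generalizing L with
  | _ n ih =>
    rcases L.eq_nil_or_concat' with rfl | ⟨L, α, rfl⟩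
    · simp
    · have hα := hL α (by simp)
      have hL' : ∀ δ ∈ L, P.IsSimple Ψ f δ := fun δ hδ => hL δ (by simp [hδ])
      have hprod : ((L ++ [α]).map P.refl).prod = (L.map P.refl).prod * P.refl α := by simp
      have hneg : f ((L.map P.refl).prod α) < 0 := by
        have h := hpos α hα.1
        rw [hprod, LinearEquiv.mul_apply, refl_self (hΨ.1 hα.1.1), map_neg, map_neg] at h
        linarith
      obtain ⟨M, hM, hlen, hMprod⟩ := hΨ.exchange hconj hf hα L hL' hneg
      rw [hprod, ← hMprod] at hpos ⊢
      rw [List.length_append, List.length_singleton] at hn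
      exact ih M.length (by omega) M hM hpos rfl

/-- An element of `W_Ψ` preserving the positive system of `Ψ` is trivial. -/
theorem IsSubsystem.eq_one_of_pos (hconj : P.ConjCompat) {Ψ : Set V} (hΨ : P.IsSubsystem Ψ)
    {f : V →ₗ[ℝ] ℝ} (hf : ∀ α ∈ Ψ, f α ≠ 0) {σ : V ≃ₗ[ℝ] V} (hσ : σ ∈ P.weylOf Ψ)
    (hpos : ∀ α ∈ posPart Ψ f, 0 < f (σ α)) : σ = 1 := by
  obtain ⟨L, hL, rfl⟩ := exists_list_of_mem_weylOf (fun α hα => hΨ.1 hα.1.1)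
    (hΨ.weylOf_le_simple hconj hf hσ)
  exact hΨ.prod_eq_one_of_pos hconj hf L hL hpos

/-- Two elements of a coset of `W_Ψ` that map the positive system of `Ψ` into the same open half
space coincide. -/
theorem IsSubsystem.eq_of_pos (hconj : P.ConjCompat) {Ψ : Set V} (hΨ : P.IsSubsystem Ψ)
    {f : V →ₗ[ℝ] ℝ} (hf : ∀ α ∈ Ψ, f α ≠ 0) (g : V →ₗ[ℝ] ℝ) {x y : V ≃ₗ[ℝ] V}
    (hy : y ∈ P.coset Ψ x) (hxpos : ∀ α ∈ posPart Ψ f, 0 < g (x α))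
    (hypos : ∀ α ∈ posPart Ψ f, 0 < g (y α)) : x = y := by
  obtain ⟨σ, hσ, rfl⟩ := hy
  rw [hΨ.eq_one_of_pos hconj hf hσ, mul_one]
  intro α hα
  have hσα := hΨ.apply_mem hσ hα.1
  by_contra hneg
  have h := hxpos (-σ α) ⟨hΨ.2.1 _ hσα, by
    rw [map_neg, neg_pos]; exact lt_of_le_of_ne (not_lt.1 hneg) (hf _ hσα)⟩
  have h' := hypos α hα
  rw [LinearEquiv.mul_apply] at h'
  rw [map_neg, map_neg] at h
  linarith

theorem coset_eq_of_mem {Ψ : Set V} {x y : V ≃ₗ[ℝ] V} (hy : y ∈ P.coset Ψ x) :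
    P.coset Ψ x = P.coset Ψ y := by
  obtain ⟨σ, hσ, rfl⟩ := hy
  ext z
  constructor
  · rintro ⟨τ, hτ, rfl⟩
    exact ⟨σ⁻¹ * τ, mul_mem (inv_mem hσ) hτ, by group⟩
  · rintro ⟨τ, hτ, rfl⟩
    exact ⟨σ * τ, mul_mem hσ hτ, by group⟩

theorem mem_weyl_of_mem_coset {Ψ : Set V} (hΨ : Ψ ⊆ P.roots) {x y : V ≃ₗ[ℝ] V}
    (hx : x ∈ P.weyl) (hy : y ∈ P.coset Ψ x) : y ∈ P.weyl := by
  obtain ⟨σ, hσ, rfl⟩ := hy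
  exact mul_mem hx (weylOf_mono hΨ hσ)

theorem IsSubsystem.image (hconj : P.ConjCompat) {Ψ : Set V} (hΨ : P.IsSubsystem Ψ)
    {w : V ≃ₗ[ℝ] V} (hw : w ∈ P.weyl) : P.IsSubsystem (w '' Ψ) := by
  refine ⟨?_, ?_, ?_⟩
  · rintro _ ⟨α, hα, rfl⟩
    exact isSubsystem_roots.apply_mem hw (hΨ.1 hα)
  · rintro _ ⟨α, hα, rfl⟩
    exact ⟨-α, hΨ.2.1 α hα, map_neg w α⟩
  · rintro _ ⟨α, hα, rfl⟩ _ ⟨β, hβ, rfl⟩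
    rw [← hconj α (hΨ.1 hα) w hw]
    exact ⟨P.refl α β, hΨ.2.2 α hα β hβ, by simp [← LinearEquiv.mul_apply]⟩

theorem weylOf_image (hconj : P.ConjCompat) {Ψ : Set V} (hΨ : Ψ ⊆ P.roots)
    {w : V ≃ₗ[ℝ] V} (hw : w ∈ P.weyl) :
    P.weylOf (w '' Ψ) = (P.weylOf Ψ).map (MulAut.conj w).toMonoidHom := by
  rw [weylOf, weylOf, MonoidHom.map_closure]
  congr 1
  ext g
  constructor
  · rintro ⟨_, ⟨α, hα, rfl⟩, rfl⟩
    exact ⟨P.refl α, ⟨α, hα, rfl⟩, hconj α (hΨ hα) w hw⟩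
  · rintro ⟨_, ⟨α, hα, rfl⟩, rfl⟩
    exact ⟨w α, ⟨α, hα, rfl⟩, hconj α (hΨ hα) w hw⟩

theorem mem_weylOf_image_iff (hconj : P.ConjCompat) {Ψ : Set V} (hΨ : Ψ ⊆ P.roots)
    {w : V ≃ₗ[ℝ] V} (hw : w ∈ P.weyl) (g : V ≃ₗ[ℝ] V) :
    g ∈ P.weylOf (w '' Ψ) ↔ ∃ σ ∈ P.weylOf Ψ, g = w * σ * w⁻¹ := by
  rw [weylOf_image hconj hΨ hw, Subgroup.mem_map]
  exact exists_congr fun σ => and_congr_right fun _ => eq_comm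

/-- The product of a coset of `W_{wΨ}` with the coset `w W_Ψ` is a coset of `W_Ψ`. -/
theorem coset_mul_coset (hconj : P.ConjCompat) {Ψ : Set V} (hΨ : Ψ ⊆ P.roots)
    {w : V ≃ₗ[ℝ] V} (hw : w ∈ P.weyl) (w' : V ≃ₗ[ℝ] V) :
    {z | ∃ x ∈ P.coset (w '' Ψ) w', ∃ y ∈ P.coset Ψ w, z = x * y} = P.coset Ψ (w' * w) := by
  ext z
  constructor
  · rintro ⟨_, ⟨τ, hτ, rfl⟩, _, ⟨σ, hσ, rfl⟩, rfl⟩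
    obtain ⟨ρ, hρ, rfl⟩ := (mem_weylOf_image_iff hconj hΨ hw τ).1 hτ
    exact ⟨ρ * σ, mul_mem hρ hσ, by group⟩
  · rintro ⟨σ, hσ, rfl⟩
    exact ⟨w', ⟨1, one_mem _, (mul_one _).symm⟩, w * σ, ⟨σ, hσ, rfl⟩, mul_assoc _ _ _⟩

end Paper.RootSystemData

open Paper

/-- **Corollary 4.2.** Let `β = w W_Ψ` be a coset with extreme elements `wmin = w^β`
(mapping `Ψ⁺` into `Φ⁺`) and `wmax = w_β` (mapping `Ψ⁺` into `Φ⁻`).  Then `Ψ' = w^β(Ψ)` is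
again a sub-root-system with `Ψ'⁺ = w^β(Ψ⁺)` and `W_{Ψ'} = w^β W_Ψ (w^β)⁻¹`; the product set
`γ ⬝ β` of a coset `γ = w' W_{Ψ'}` with `β` is a single coset of `W_Ψ`, and the extreme
elements satisfy `w^γ w^β = w^{γβ}`, `w^γ w_β = w_{γβ}` and `w_γ w^β = w_{γβ}`. -/
theorem extreme_elements_multiply
    {V : Type*} [AddCommGroup V] [Module ℝ V]
    (P : RootSystemData V) (hconj : P.ConjCompat) (hWfin : Finite P.weyl)
    (Pos : Set V) (hPos : IsPositiveSystem P.roots Pos)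
    (Ψ : Set V) (hΨ : P.IsSubsystem Ψ)
    (w : V ≃ₗ[ℝ] V) (hw : w ∈ P.weyl)
    -- the minimal element `w^β` of the coset `β = w W_Ψ`
    (wmin : V ≃ₗ[ℝ] V) (hwmin : wmin ∈ P.coset Ψ w)
    (hwminpos : ∀ α ∈ Ψ ∩ Pos, wmin α ∈ Pos)
    -- the maximal element `w_β` of the coset `β = w W_Ψ`
    (wmax : V ≃ₗ[ℝ] V) (hwmax : wmax ∈ P.coset Ψ w)
    (hwmaxneg : ∀ α ∈ Ψ ∩ Pos, wmax α ∈ -Pos)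
    -- a coset `γ = w' W_{Ψ'}` of `W_{Ψ'}`, where `Ψ' = w^β (Ψ)`
    (w' : V ≃ₗ[ℝ] V) (hw' : w' ∈ P.weyl)
    -- the minimal element `w^γ` of `γ`
    (wmin' : V ≃ₗ[ℝ] V) (hwmin' : wmin' ∈ P.coset (⇑wmin '' Ψ) w')
    (hwmin'pos : ∀ α ∈ (⇑wmin '' Ψ) ∩ Pos, wmin' α ∈ Pos)
    -- the maximal element `w_γ` of `γ`
    (wmax' : V ≃ₗ[ℝ] V) (hwmax' : wmax' ∈ P.coset (⇑wmin '' Ψ) w')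
    (hwmax'neg : ∀ α ∈ (⇑wmin '' Ψ) ∩ Pos, wmax' α ∈ -Pos)
    -- the minimal element `w^{γβ}` of the product set `γ ⬝ β`
    (vmin : V ≃ₗ[ℝ] V)
    (hvmin : vmin ∈ {z | ∃ x ∈ P.coset (⇑wmin '' Ψ) w', ∃ y ∈ P.coset Ψ w, z = x * y})
    (hvminpos : ∀ α ∈ Ψ ∩ Pos, vmin α ∈ Pos)
    -- the maximal element `w_{γβ}` of the product set `γ ⬝ β`
    (vmax : V ≃ₗ[ℝ] V)
    (hvmax : vmax ∈ {z | ∃ x ∈ P.coset (⇑wmin '' Ψ) w', ∃ y ∈ P.coset Ψ w, z = x * y})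
    (hvmaxneg : ∀ α ∈ Ψ ∩ Pos, vmax α ∈ -Pos) :
    P.IsSubsystem (⇑wmin '' Ψ) ∧
    (⇑wmin '' Ψ) ∩ Pos = ⇑wmin '' (Ψ ∩ Pos) ∧
    (∀ g, g ∈ P.weylOf (⇑wmin '' Ψ) ↔ ∃ σ ∈ P.weylOf Ψ, g = wmin * σ * wmin⁻¹) ∧
    {z | ∃ x ∈ P.coset (⇑wmin '' Ψ) w', ∃ y ∈ P.coset Ψ w, z = x * y} =
      P.coset Ψ (wmin' * wmin) ∧
    wmin' * wmin = vmin ∧ wmin' * wmax = vmax ∧ wmax' * wmin = vmax := by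
  obtain ⟨f, hf, rfl⟩ := hPos
  have hwminW := RootSystemData.mem_weyl_of_mem_coset hΨ.1 hw hwmin
  have hΨ' := hΨ.image hconj hwminW
  have hfΨ : ∀ α ∈ Ψ, f α ≠ 0 := fun α hα => hf α (hΨ.1 hα)
  have hpos : ∀ α ∈ RootSystemData.posPart Ψ f, α ∈ Ψ ∩ {α | α ∈ P.roots ∧ 0 < f α} :=
    fun α hα => ⟨hα.1, hΨ.1 hα.1, hα.2⟩
  have hprod := RootSystemData.coset_mul_coset hconj hΨ.1 hwminW wmin'
  have hw_eq := RootSystemData.coset_eq_of_mem hwmin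
  have hw'_eq := RootSystemData.coset_eq_of_mem hwmin'
  rw [hw_eq] at hwmin hwmax
  rw [hw'_eq] at hwmin' hwmax'
  rw [hw_eq, hw'_eq] at hvmin hvmax ⊢
  rw [hprod] at hvmin hvmax
  have hmem : wmax' * wmin ∈ P.coset Ψ (wmin' * wmin) :=
    hprod ▸ ⟨wmax', hwmax', wmin, hwmin, rfl⟩
  have hmem' : wmin' * wmax ∈ P.coset Ψ (wmin' * wmin) :=
    hprod ▸ ⟨wmin', hwmin', wmax, hwmax, rfl⟩
  refine ⟨hΨ', ?_, RootSystemData.mem_weylOf_image_iff hconj hΨ.1 hwminW, hprod, ?_, ?_, ?_⟩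
  · ext x
    constructor
    · rintro ⟨⟨α, hα, rfl⟩, hx⟩
      refine ⟨α, ⟨hα, hΨ.1 hα, ?_⟩, rfl⟩
      by_contra hneg
      have h := (hwminpos (-α) (hpos _ ⟨hΨ.2.1 α hα, by
        rw [map_neg, neg_pos]; exact lt_of_le_of_ne (not_lt.1 hneg) (hfΨ α hα)⟩)).2
      rw [map_neg, map_neg] at h
      linarith [hx.2]
    · rintro ⟨α, hα, rfl⟩
      exact ⟨⟨α, hα.1, rfl⟩, hwminpos α hα⟩
  · exact hΨ.eq_of_pos hconj hfΨ f hvmin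
      (fun α hα => (hwmin'pos _ ⟨⟨α, hα.1, rfl⟩, hwminpos α (hpos α hα)⟩).2)
      (fun α hα => (hvminpos α (hpos α hα)).2)
  · refine hΨ.eq_of_pos hconj hfΨ (-f) (RootSystemData.coset_eq_of_mem hmem' ▸ hvmax) ?_ ?_
    · intro α hα
      obtain ⟨τ, hτ, rfl⟩ := hwmax
      have h := (hwmin'pos (-(wmin * τ) α) ⟨⟨-τ α, hΨ.2.1 _ (hΨ.apply_mem hτ hα.1), by simp⟩,
        hwmaxneg α (hpos α hα)⟩).2
      simpa using h
    · intro α hα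
      simpa using (hvmaxneg α (hpos α hα)).2
  · refine hΨ.eq_of_pos hconj hfΨ (-f) (RootSystemData.coset_eq_of_mem hmem ▸ hvmax) ?_ ?_
    · intro α hα
      simpa using (hwmax'neg _ ⟨⟨α, hα.1, rfl⟩, hwminpos α (hpos α hα)⟩).2
    · intro α hα
      simpa using (hvmaxneg α (hpos α hα)).2
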